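/- arXiv:math/0609242 — 8 statements merged into one kernel-verified Lean document; each statement's English description precedes it below -/
import Mathlib

section
/- Let n ≥ 1 and let P_n = ⟨a_0, …, a_k⟩ be the n-th P-sequence. Then for every integer s with 0 ≤ s ≤ n-1, the polynomial function F_{n,s}(x) = ∑_{i=0}^k a_i (i+x)^s is identically zero on ℝ. -/
/-- One step of the recursive construction of P-sequences. -/
def Pnext (a : List ℤ) : List ℤ :=
  if a.getLast! = -a.head! then a ++ a.reverse
  else a.dropLast ++ [0] ++ (a.dropLast.reverse.map (fun x => -x))

/-- `Pseq (n-1)` is the `n`-th P-sequence `P_n` (so `Pseq 0 = P_1 = ⟨1,-1⟩`). -/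
def Pseq : ℕ → List ℤ
  | 0 => [1, -1]
  | n + 1 => Pnext (Pseq n)

/-- The pairing `∑ aᵢ f(i)` of a list of integer weights with a real sequence. -/
def weightedSum : List ℤ → (ℕ → ℝ) → ℝ
  | [], _ => 0
  | c :: l, f => (c : ℝ) * f 0 + weightedSum l (fun i => f (i + 1))

theorem weightedSum_eq_sum_range (l : List ℤ) (f : ℕ → ℝ) :
    weightedSum l f = ∑ i ∈ Finset.range l.length, ((l.getD i 0 : ℤ) : ℝ) * f i := by
  induction l generalizing f with
  | nil => simp [weightedSum]
  | cons c l ih => simp [weightedSum, ih, Finset.sum_range_succ', add_comm]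

theorem weightedSum_append (l m : List ℤ) (f : ℕ → ℝ) :
    weightedSum (l ++ m) f = weightedSum l f + weightedSum m (fun i => f (i + l.length)) := by
  induction l generalizing f with
  | nil => simp [weightedSum]
  | cons c l ih => simp [weightedSum, ih, add_assoc]

theorem weightedSum_map_neg (l : List ℤ) (f : ℕ → ℝ) :
    weightedSum (l.map (fun x => -x)) f = -weightedSum l f := by
  induction l generalizing f with
  | nil => simp [weightedSum]
  | cons c l ih => simp [weightedSum, ih, add_comm]

/-- Weights that start with `1`, have length at least two, and are antisymmetric or symmetric. -/
def IsSignedPalindrome (a : List ℤ) : Prop :=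
  (∃ b t, a = 1 :: b :: t) ∧ (a.reverse = a.map (fun x => -x) ∨ a.reverse = a)

theorem Pnext_eq_of_reverse_eq_map_neg {a : List ℤ} (h : ∃ b t, a = 1 :: b :: t)
    (ha : a.reverse = a.map (fun x => -x)) : Pnext a = a ++ a.map (fun x => -x) := by
  obtain ⟨b, t, rfl⟩ := h
  have hl : (1 :: b :: t).getLast! = -(1 :: b :: t).head! := by
    rw [List.getLast!_eq_getLast?_getD, ← List.head?_reverse, ha]
    simp
  rw [Pnext, if_pos hl, ha]

theorem Pnext_eq_of_reverse_eq {a : List ℤ} (h : ∃ b t, a = 1 :: b :: t)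
    (ha : a.reverse = a) :
    Pnext a = a.dropLast ++ 0 :: a.tail.map (fun x => -x) := by
  have hr : a.dropLast.reverse = a.tail := by rw [← List.tail_reverse, ha]
  obtain ⟨b, t, rfl⟩ := h
  have hl : ¬ (1 :: b :: t).getLast! = -(1 :: b :: t).head! := by
    rw [List.getLast!_eq_getLast?_getD, ← List.head?_reverse, ha]
    simp
  rw [Pnext, if_neg hl, hr]
  simp

theorem IsSignedPalindrome.pnext {a : List ℤ} (h : IsSignedPalindrome a) :
    IsSignedPalindrome (Pnext a) := by
  obtain ⟨h, ha | ha⟩ := h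
  · rw [Pnext_eq_of_reverse_eq_map_neg h ha]
    obtain ⟨b, t, rfl⟩ := h
    refine ⟨⟨b, _, rfl⟩, Or.inr ?_⟩
    rw [List.reverse_append, ← List.map_reverse, ha]
    simp
  · rw [Pnext_eq_of_reverse_eq h ha]
    have hr : a.tail.reverse = a.dropLast := by rw [← List.dropLast_reverse, ha]
    have hr' : a.dropLast.reverse = a.tail := by rw [← List.tail_reverse, ha]
    refine ⟨?_, Or.inl ?_⟩
    · obtain ⟨b, t, rfl⟩ := h
      cases t <;> simp
    · simp only [List.reverse_append, List.reverse_cons, ← List.map_reverse, hr, hr']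
      simp

theorem IsSignedPalindrome.exists_weightedSum_Pnext {a : List ℤ} (h : IsSignedPalindrome a) :
    ∃ m : ℕ, ∀ f : ℕ → ℝ,
      weightedSum (Pnext a) f = weightedSum a f - weightedSum a (fun i => f (i + m)) := by
  obtain ⟨h, ha | ha⟩ := h
  · refine ⟨a.length, fun f => ?_⟩
    rw [Pnext_eq_of_reverse_eq_map_neg h ha, weightedSum_append, weightedSum_map_neg,
      sub_eq_add_neg]
  · refine ⟨a.dropLast.length, fun f => ?_⟩
    have hd : a = a.dropLast ++ [1] := by
      conv_lhs => rw [← ha]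
      have hr : a.tail.reverse = a.dropLast := by rw [← List.dropLast_reverse, ha]
      obtain ⟨b, t, rfl⟩ := h
      rw [List.reverse_cons, ← hr]
      simp
    have ht : a = 1 :: a.tail := by
      obtain ⟨b, t, rfl⟩ := h
      rfl
    have hs : weightedSum a f = weightedSum a.dropLast f + f a.dropLast.length := by
      conv_lhs => rw [hd, weightedSum_append]
      simp [weightedSum]
    have hc (g : ℕ → ℝ) : weightedSum a g = g 0 + weightedSum a.tail (fun i => g (i + 1)) := by
      conv_lhs => rw [ht]
      simp [weightedSum]
    rw [Pnext_eq_of_reverse_eq h ha, weightedSum_append, hs, hc]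
    simp only [weightedSum, weightedSum_map_neg, Int.cast_zero, zero_mul, zero_add]
    ring

theorem isSignedPalindrome_Pseq (n : ℕ) : IsSignedPalindrome (Pseq n) := by
  induction n with
  | zero => exact ⟨⟨-1, [], rfl⟩, Or.inl rfl⟩
  | succ n ih => exact ih.pnext

theorem weightedSum_sum {ι : Type*} (l : List ℤ) (s : Finset ι) (c : ι → ℝ) (f : ι → ℕ → ℝ) :
    weightedSum l (fun i => ∑ j ∈ s, f j i * c j) = ∑ j ∈ s, weightedSum l (f j) * c j := by
  simp only [weightedSum_eq_sum_range, Finset.mul_sum, Finset.sum_mul, mul_assoc]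
  exact Finset.sum_comm

theorem weightedSum_Pseq_pow (n s : ℕ) (hs : s ≤ n) (x : ℝ) :
    weightedSum (Pseq n) (fun i => ((i : ℝ) + x) ^ s) = 0 := by
  induction n generalizing s with
  | zero =>
    obtain rfl : s = 0 := by omega
    simp [Pseq, weightedSum]
  | succ n ih =>
    obtain ⟨m, hm⟩ := (isSignedPalindrome_Pseq n).exists_weightedSum_Pnext
    have hexp : (fun i : ℕ => (((i + m : ℕ) : ℝ) + x) ^ s) = fun i : ℕ =>
        ∑ j ∈ Finset.range (s + 1), ((i : ℝ) + x) ^ j * ((m : ℝ) ^ (s - j) * s.choose j) := by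
      funext i
      rw [Nat.cast_add, add_right_comm, add_pow]
      simp only [mul_assoc]
    have hlow : ∑ j ∈ Finset.range s, weightedSum (Pseq n) (fun i => ((i : ℝ) + x) ^ j) *
        ((m : ℝ) ^ (s - j) * s.choose j) = 0 :=
      Finset.sum_eq_zero fun j hj => by
        rw [ih j (by have := Finset.mem_range.mp hj; omega), zero_mul]
    rw [Pseq, hm, hexp, weightedSum_sum, Finset.sum_range_succ, hlow]
    simp

/-- for `n ≥ 1`, `P_n = ⟨a_0,…,a_k⟩` and `0 ≤ s ≤ n-1`, the function
`F_{n,s}(x) = ∑_{i=0}^k a_i (i+x)^s` is identically zero on `ℝ`. -/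
theorem Fns_eq_zero (n : ℕ) (hn : 1 ≤ n) (s : ℕ) (hs : s ≤ n - 1) (x : ℝ) :
    ∑ i ∈ Finset.range (Pseq (n - 1)).length,
      (((Pseq (n - 1)).getD i 0 : ℝ) * ((i : ℝ) + x) ^ s) = 0 := by
  rw [← weightedSum_eq_sum_range (Pseq (n - 1)) (fun i => ((i : ℝ) + x) ^ s)]
  exact weightedSum_Pseq_pow (n - 1) s hs x
end

section
/- Let φ denote Euler's totient function. The set A = {φ(n)/n : n ∈ ℕ, n ≥ 1} is dense in the real interval [0,1]. -/
/-- The product of the primes in `[K, K + m)`. -/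
def primeProdFrom (K m : ℕ) : ℕ :=
  ∏ i ∈ Finset.range m, if (K + i).Prime then K + i else 1

lemma primeProdFrom_pos (K m : ℕ) : 0 < primeProdFrom K m := by
  refine Finset.prod_pos fun i _ => ?_
  split_ifs with h
  exacts [h.pos, one_pos]

lemma coprime_primeProdFrom {K m : ℕ} (h : (K + m).Prime) :
    (primeProdFrom K m).Coprime (K + m) := by
  refine Nat.Coprime.prod_left fun i hi => ?_
  have hi := Finset.mem_range.mp hi
  split_ifs with h'
  · exact (Nat.coprime_primes h' h).mpr (by omega)
  · exact Nat.coprime_one_left _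

lemma totient_primeProdFrom_div (K m : ℕ) :
    ((primeProdFrom K m).totient : ℝ) / primeProdFrom K m =
      ∏ i ∈ Finset.range m,
        (1 - Set.indicator {p : ℕ | p.Prime} (fun n => (1 : ℝ) / n) (K + i)) := by
  induction m with
  | zero => simp [primeProdFrom]
  | succ m ih =>
    rw [Finset.prod_range_succ, ← ih]
    have hpos : (primeProdFrom K m : ℝ) ≠ 0 := by exact_mod_cast (primeProdFrom_pos K m).ne'
    by_cases h : (K + m).Prime
    · have hs : primeProdFrom K (m + 1) = primeProdFrom K m * (K + m) := by
        rw [primeProdFrom, Finset.prod_range_succ, if_pos h, ← primeProdFrom]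
      have hp : ((K + m : ℕ) : ℝ) ≠ 0 := by exact_mod_cast h.ne_zero
      rw [hs, Nat.totient_mul (coprime_primeProdFrom h), Nat.totient_prime h,
        Set.indicator_of_mem (by exact h), Nat.cast_mul, Nat.cast_mul, Nat.cast_sub h.one_le]
      field_simp
      simp
    · have hs : primeProdFrom K (m + 1) = primeProdFrom K m := by
        rw [primeProdFrom, Finset.prod_range_succ, if_neg h, ← primeProdFrom, mul_one]
      rw [hs, Set.indicator_of_notMem (by exact h), sub_zero, mul_one]

lemma tendsto_prod_one_sub_of_not_summable {f : ℕ → ℝ} (h0 : ∀ n, 0 ≤ f n) (h1 : ∀ n, f n ≤ 1)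
    (hf : ¬ Summable f) :
    Filter.Tendsto (fun m => ∏ i ∈ Finset.range m, (1 - f i)) Filter.atTop (nhds 0) := by
  have hsum := (not_summable_iff_tendsto_nat_atTop_of_nonneg h0).mp hf
  refine squeeze_zero (fun m => Finset.prod_nonneg fun i _ => sub_nonneg.mpr (h1 i)) (fun m => ?_)
    (Real.tendsto_exp_neg_atTop_nhds_zero.comp hsum)
  rw [Function.comp_apply, ← Finset.sum_neg_distrib, Real.exp_sum]
  exact Finset.prod_le_prod (fun i _ => sub_nonneg.mpr (h1 i))
    fun i _ => Real.one_sub_le_exp_neg _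

/-- the set `A = {φ(n)/n : n ≥ 1}`, where `φ` is Euler's totient
function, is dense in the real interval `[0,1]`. -/
theorem totient_ratio_dense_in_unit_interval :
    Set.Icc (0 : ℝ) 1 ⊆
      closure {x : ℝ | ∃ n : ℕ, 1 ≤ n ∧ x = (Nat.totient n : ℝ) / n} := by
  rintro x ⟨hx0, hx1⟩
  rw [Metric.mem_closure_iff]
  intro ε hε
  obtain ⟨k, hk⟩ := exists_nat_one_div_lt hε
  set f : ℕ → ℝ := fun i =>
    Set.indicator {p : ℕ | p.Prime} (fun n => (1 : ℝ) / n) (k + 1 + i) with hf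
  have hf0 (i) : 0 ≤ f i := Set.indicator_nonneg (fun n _ => by positivity) _
  have hfk (i) : f i ≤ 1 / ((k : ℝ) + 1) := by
    refine (Set.indicator_le_self' (fun n _ => by positivity) (k + 1 + i)).trans ?_
    refine one_div_le_one_div_of_le (by positivity) ?_
    push_cast
    linarith [i.cast_nonneg (α := ℝ)]
  have hf1 (i) : f i ≤ 1 := (hfk i).trans <| by
    rw [div_le_one (by positivity)]
    simp
  have hfs : ¬ Summable f := by
    simp only [hf, add_comm (k + 1)]
    rw [summable_nat_add_iff (k + 1)]
    exact not_summable_one_div_on_primes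
  set P : ℕ → ℝ := fun m => ∏ i ∈ Finset.range m, (1 - f i) with hP
  have hlim : Filter.Tendsto P Filter.atTop (nhds 0) :=
    tendsto_prod_one_sub_of_not_summable hf0 hf1 hfs
  have hP1 (m) : P m ≤ 1 :=
    Finset.prod_le_one (fun i _ => sub_nonneg.mpr (hf1 i)) fun i _ => sub_le_self _ (hf0 i)
  have hex : ∃ m, P m < x + ε := (hlim.eventually_lt_const (by linarith)).exists
  have hlow : ∃ m, P m < x + ε ∧ x - ε < P m := by
    classical
    refine ⟨Nat.find hex, Nat.find_spec hex, ?_⟩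
    rcases hm : Nat.find hex with _ | m
    · simp only [hP, Finset.range_zero, Finset.prod_empty]
      linarith
    · have hge : x + ε ≤ P m := not_lt.mp (Nat.find_min hex (by omega))
      have hstep : P (m + 1) = P m * (1 - f m) := Finset.prod_range_succ _ _
      nlinarith [hP1 m, hf0 m, hfk m]
  obtain ⟨m, hm1, hm2⟩ := hlow
  refine ⟨P m, ⟨primeProdFrom (k + 1) m, primeProdFrom_pos _ _,
    (totient_primeProdFrom_div (k + 1) m).symm⟩, ?_⟩
  rw [Real.dist_eq, abs_lt]
  constructor <;> linarith
end

section
/- For every real number r > 0 there exists a set S of prime numbers such that ∑_{p∈S} (-log(1 - 1/p)) = r; equivalently, for every t ∈ (0,1) there exists a set S of primes with ∏_{p∈S} (1 - 1/p) = t. -/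
open Filter Topology in
/-- A nonnegative null sequence with divergent sum has a subseries with any prescribed nonnegative
sum. -/
theorem exists_hasSum_indicator_of_not_summable {f : ℕ → ℝ} (hf : ∀ n, 0 ≤ f n)
    (hlim : Tendsto f atTop (𝓝 0)) (hdiv : ¬ Summable f) {r : ℝ} (hr : 0 ≤ r) :
    ∃ S : Set ℕ, HasSum (S.indicator f) r := by
  classical
  -- greedy partial sums: add `f n` whenever this does not exceed `r`
  let s : ℕ → ℝ := fun n => Nat.rec 0 (fun k x => if x + f k ≤ r then x + f k else x) n
  have hsucc (n : ℕ) : s (n + 1) = if s n + f n ≤ r then s n + f n else s n := rfl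
  let S : Set ℕ := {n | s n + f n ≤ r}
  have hsum (n : ℕ) : ∑ k ∈ Finset.range n, S.indicator f k = s n := by
    induction n with
    | zero => rfl
    | succ n ih =>
      rw [Finset.sum_range_succ, ih, hsucc, Set.indicator_apply]
      by_cases h : s n + f n ≤ r <;> simp [S, h]
  have hle (n : ℕ) : s n ≤ r := by
    induction n with
    | zero => exact hr
    | succ n ih => rw [hsucc]; split_ifs with h <;> assumption
  have hnonneg (n : ℕ) : 0 ≤ S.indicator f n := Set.indicator_nonneg (fun n _ => hf n) n
  have hS : Summable (S.indicator f) :=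
    summable_of_sum_range_le hnonneg fun n => (hsum n).trans_le (hle n)
  have hsL (n : ℕ) : s n ≤ ∑' k, S.indicator f k :=
    hsum n ▸ hS.sum_le_tsum _ fun k _ => hnonneg k
  have hL : ∑' k, S.indicator f k ≤ r :=
    hS.tsum_le_of_sum_range_le fun n => (hsum n).trans_le (hle n)
  refine ⟨S, ?_⟩
  rcases hL.eq_or_lt with h | h
  · exact h ▸ hS.hasSum
  · obtain ⟨N, hN⟩ := eventually_atTop.1 (hlim.eventually_lt_const (sub_pos.2 h))
    refine absurd ((summable_nat_add_iff N).1 ?_) hdiv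
    refine ((summable_nat_add_iff N).2 hS).congr fun n => ?_
    have hmem : n + N ∈ S := by
      have h₁ := hN (n + N) (Nat.le_add_left N n)
      have h₂ := hsL (n + N)
      change s (n + N) + f (n + N) ≤ r
      linarith
    simp [Set.indicator_of_mem hmem]

open Filter Topology in
/-- Every `r ≥ 0` is a sum of `-log (1 - 1 / p)` over some set of primes. -/
theorem exists_primes_hasSum_neg_log_one_sub_inv {r : ℝ} (hr : 0 ≤ r) :
    ∃ S : Set ℕ, (∀ p ∈ S, Nat.Prime p) ∧
      HasSum (fun p : S => -Real.log (1 - 1 / (p : ℝ))) r := by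
  let g : ℕ → ℝ := fun n => -Real.log (1 - 1 / (n : ℝ))
  let P : Set ℕ := {p | p.Prime}
  have hg (n : ℕ) : 0 ≤ g n := by
    have h₁ : 1 / (n : ℝ) ≤ 1 := by simpa using Nat.cast_inv_le_one (α := ℝ) n
    have h₀ : 0 ≤ 1 / (n : ℝ) := by positivity
    exact neg_nonneg.2 (Real.log_nonpos (by linarith) (by linarith))
  have hg_lim : Tendsto g atTop (𝓝 0) := by
    have h : Tendsto (fun n : ℕ => 1 - 1 / (n : ℝ)) atTop (𝓝 1) := by
      simpa using tendsto_one_div_atTop_nhds_zero_nat (𝕜 := ℝ) |>.const_sub 1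
    simpa [g] using (h.log one_ne_zero).neg
  have hdiv : ¬ Summable (P.indicator g) := by
    refine fun h => not_summable_one_div_on_primes (h.of_nonneg_of_le
      (Set.indicator_nonneg fun n _ => by positivity) fun n => ?_)
    by_cases hn : n.Prime
    · have h₁ : 1 / (n : ℝ) < 1 :=
        (div_lt_one (by exact_mod_cast hn.pos)).2 (by exact_mod_cast hn.one_lt)
      have h₂ := Real.log_le_sub_one_of_pos (sub_pos.2 h₁)
      rw [Set.indicator_of_mem (by exact hn), Set.indicator_of_mem (by exact hn)]
      change 1 / (n : ℝ) ≤ -Real.log (1 - 1 / (n : ℝ))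
      linarith
    · rw [Set.indicator_of_notMem (by exact hn), Set.indicator_of_notMem (by exact hn)]
  obtain ⟨T, hT⟩ := exists_hasSum_indicator_of_not_summable
    (Set.indicator_nonneg fun n _ => hg n)
    (squeeze_zero (Set.indicator_nonneg fun n _ => hg n)
      (Set.indicator_le_self' fun n _ => hg n) hg_lim) hdiv hr
  refine ⟨T ∩ P, fun p hp => hp.2, ?_⟩
  rw [Set.indicator_indicator] at hT
  exact hasSum_subtype_iff_indicator.2 hT

/-- every `r > 0` equals `∑_{p∈S} (-log(1-1/p))` for some set `S` of
primes; equivalently, every `t ∈ (0,1)` equals `∏_{p∈S} (1-1/p)` for some set `S`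
of primes. -/
theorem prime_log_sum_and_product_representation :
    (∀ r : ℝ, 0 < r → ∃ S : Set ℕ, (∀ p ∈ S, Nat.Prime p) ∧
      HasSum (fun p : S => -Real.log (1 - 1 / (p : ℝ))) r) ∧
    (∀ t : ℝ, t ∈ Set.Ioo (0 : ℝ) 1 → ∃ S : Set ℕ, (∀ p ∈ S, Nat.Prime p) ∧
      HasProd (fun p : S => 1 - 1 / (p : ℝ)) t) := by
  refine ⟨fun r hr => exists_primes_hasSum_neg_log_one_sub_inv hr.le, fun t ht => ?_⟩
  obtain ⟨S, hS, hsum⟩ := exists_primes_hasSum_neg_log_one_sub_inv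
    (neg_nonneg.2 (Real.log_nonpos ht.1.le ht.2.le))
  refine ⟨S, hS, ?_⟩
  have h := hsum.neg.rexp
  rw [neg_neg, Real.exp_log ht.1] at h
  refine h.congr_fun fun p => ?_
  have hp : (1 : ℝ) < p := by exact_mod_cast (hS p p.2).one_lt
  have : 1 / (p : ℝ) < 1 := (div_lt_one (by linarith)).2 hp
  simp only [Function.comp_apply, neg_neg]
  rw [Real.exp_log (by linarith)]
end

section
/- Let E : ℕ → ℝ be a sequence of positive real numbers such that E(n) → 0 as n → ∞ and ∑_{n=0}^∞ E(n) = ∞, and let r ≥ 0 be a real number. Then the sequence r + E = ⟨r + E(n) : n ∈ ℕ⟩ is dense-expandable, i.e., the set X(r+E) = {∑_{n∈S} ε_n (r + E(n)) : S a finite subset of ℕ, ε_n ∈ {-1,1}} is dense in ℝ. -/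
open Filter

/-- Partial sums of a divergent series with terms less than `δ` come within `δ` of every
nonnegative real from above. -/
theorem exists_sum_range_mem_Ico {f : ℕ → ℝ} {δ x : ℝ} (hδ : 0 < δ) (hf : ∀ n, f n < δ)
    (hdiv : Tendsto (fun N => ∑ n ∈ Finset.range N, f n) atTop atTop) (hx : 0 ≤ x) :
    ∃ k, x ≤ ∑ i ∈ Finset.range k, f i ∧ ∑ i ∈ Finset.range k, f i < x + δ := by
  classical
  have hex : ∃ k, x ≤ ∑ i ∈ Finset.range k, f i := (hdiv.eventually_ge_atTop x).exists
  refine ⟨Nat.find hex, Nat.find_spec hex, ?_⟩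
  rcases hk : Nat.find hex with _ | k
  · simp only [Finset.range_zero, Finset.sum_empty]
    linarith
  · have hlt := Nat.find_min hex (m := k) (by omega)
    rw [Finset.sum_range_succ]
    linarith [hf k, not_le.mp hlt]

/-- A nonnegative real is approximated by differences of two sums of equally many terms of `E`
over disjoint blocks of indices. -/
theorem exists_abs_sub_sum_range_sub_lt {E : ℕ → ℝ} (hpos : ∀ n, 0 < E n)
    (hlim : Tendsto E atTop (nhds 0))
    (hdiv : Tendsto (fun N => ∑ n ∈ Finset.range N, E n) atTop atTop)
    {x δ : ℝ} (hx : 0 ≤ x) (hδ : 0 < δ) :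
    ∃ N k L : ℕ, N + k ≤ L ∧
      |x - (∑ i ∈ Finset.range k, E (N + i) - ∑ i ∈ Finset.range k, E (L + i))| < δ := by
  obtain ⟨N, hN⟩ := eventually_atTop.mp (hlim.eventually_lt_const hδ)
  have htail : Tendsto (fun k => ∑ i ∈ Finset.range k, E (N + i)) atTop atTop := by
    have h := tendsto_atTop_add_const_right atTop (-∑ i ∈ Finset.range N, E i)
      (hdiv.comp (tendsto_add_atTop_nat N))
    refine h.congr fun k => ?_
    simp only [Function.comp_apply]
    rw [add_comm k N, Finset.sum_range_add]
    ring
  obtain ⟨k, hk₁, hk₂⟩ :=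
    exists_sum_range_mem_Ico hδ (fun i => hN (N + i) (by omega)) htail hx
  have hδk : 0 < δ / (k + 1) := by positivity
  obtain ⟨M, hM⟩ := eventually_atTop.mp (hlim.eventually_lt_const hδk)
  refine ⟨N, k, M + (N + k), by omega, ?_⟩
  have hnonneg : 0 ≤ ∑ i ∈ Finset.range k, E (M + (N + k) + i) :=
    Finset.sum_nonneg fun i _ => (hpos _).le
  have hle : ∑ i ∈ Finset.range k, E (M + (N + k) + i) ≤ k * (δ / (k + 1)) := by
    simpa using Finset.sum_le_card_nsmul (Finset.range k) (fun i => E (M + (N + k) + i)) _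
      fun i _ => (hM (M + (N + k) + i) (by omega)).le
  have heq : k * (δ / (k + 1)) + δ / (k + 1) = δ := by
    field_simp
  rw [abs_lt]
  constructor <;> linarith

/-- A difference of two sums of equally many terms of `E` over disjoint blocks of indices, up to
sign, is a signed sum of terms of `r + E`. -/
theorem exists_signed_sum_eq (E : ℕ → ℝ) (r : ℝ) {N k L : ℕ} (hL : N + k ≤ L) {s : ℝ}
    (hs : s = -1 ∨ s = 1) :
    ∃ S : Finset ℕ, ∃ ε : ℕ → ℝ, (∀ n ∈ S, ε n = -1 ∨ ε n = 1) ∧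
      s * (∑ i ∈ Finset.range k, E (N + i) - ∑ i ∈ Finset.range k, E (L + i)) =
        ∑ n ∈ S, ε n * (r + E n) := by
  refine ⟨Finset.Ico N (N + k) ∪ Finset.Ico L (L + k), fun n => if n < L then s else -s,
    fun n _ => ?_, ?_⟩
  · dsimp only
    split_ifs
    · exact hs
    · rcases hs with rfl | rfl <;> simp
  · have hdisj : Disjoint (Finset.Ico N (N + k)) (Finset.Ico L (L + k)) := by
      rw [Finset.disjoint_left]
      intro n hn hn'
      rw [Finset.mem_Ico] at hn hn'
      omega
    have h₁ : ∑ n ∈ Finset.Ico N (N + k), (if n < L then s else -s) * (r + E n) =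
        ∑ i ∈ Finset.range k, s * (r + E (N + i)) := by
      rw [Finset.sum_Ico_eq_sum_range, Nat.add_sub_cancel_left]
      refine Finset.sum_congr rfl fun i hi => ?_
      rw [Finset.mem_range] at hi
      rw [if_pos (by omega)]
    have h₂ : ∑ n ∈ Finset.Ico L (L + k), (if n < L then s else -s) * (r + E n) =
        ∑ i ∈ Finset.range k, -s * (r + E (L + i)) := by
      rw [Finset.sum_Ico_eq_sum_range, Nat.add_sub_cancel_left]
      refine Finset.sum_congr rfl fun i _ => ?_
      rw [if_neg (by omega)]
    rw [Finset.sum_union hdisj, h₁, h₂, ← Finset.mul_sum, ← Finset.mul_sum,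
      Finset.sum_add_distrib, Finset.sum_add_distrib]
    ring

/-- if `E` is a sequence of positive reals with `E(n) → 0` and
`∑ E(n) = ∞`, then for every `r ≥ 0` the sequence `r + E` is dense-expandable:
the set `X(r+E)` of finite signed sums `∑_{n∈S} ε_n (r + E(n))` (`ε_n ∈ {-1,1}`)
is dense in `ℝ`. -/
theorem shifted_sequence_dense_expandable (E : ℕ → ℝ)
    (hpos : ∀ n, 0 < E n) (hlim : Tendsto E atTop (nhds 0))
    (hdiv : Tendsto (fun N => ∑ n ∈ Finset.range N, E n) atTop atTop)
    (r : ℝ) (hr : 0 ≤ r) :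
    Dense {x : ℝ | ∃ S : Finset ℕ, ∃ ε : ℕ → ℝ,
      (∀ n ∈ S, ε n = -1 ∨ ε n = 1) ∧ x = ∑ n ∈ S, ε n * (r + E n)} := by
  rw [Metric.dense_iff]
  intro x δ hδ
  obtain ⟨N, k, L, hL, h⟩ := exists_abs_sub_sum_range_sub_lt hpos hlim hdiv (abs_nonneg x) hδ
  obtain ⟨s, hs, hsx⟩ : ∃ s : ℝ, (s = -1 ∨ s = 1) ∧ s * |x| = x := by
    rcases le_total 0 x with hx | hx
    · exact ⟨1, Or.inr rfl, by rw [abs_of_nonneg hx, one_mul]⟩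
    · exact ⟨-1, Or.inl rfl, by rw [abs_of_nonpos hx]; ring⟩
  refine ⟨_, ?_, exists_signed_sum_eq E r hL hs⟩
  have habs : |s| = 1 := by rcases hs with rfl | rfl <;> simp
  rw [Metric.mem_ball, dist_comm, Real.dist_eq]
  nth_rewrite 1 [← hsx]
  rwa [← mul_sub, abs_mul, habs, one_mul]
end

section
/- For a real number δ, the sequence ⟨n^δ : n ∈ ℕ, n ≥ 1⟩ is dense-expandable if and only if δ = -1, or δ > -1 and δ is not an integer. -/
/-- The iterated difference of `f` with steps `1, 2, 4, …, 2 ^ (j - 1)`. -/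
noncomputable def dyadicDiff (f : ℝ → ℝ) : ℕ → ℝ → ℝ
  | 0, x => f x
  | j + 1, x => dyadicDiff f j (x + 2 ^ j) - dyadicDiff f j x

/-- `x` is a sum of the terms `n ^ δ` with `n ∈ S`, each taken with a sign. -/
def IsSignedSum (δ : ℝ) (S : Finset ℕ) (x : ℝ) : Prop :=
  ∃ ε : ℕ → ℝ, (∀ n ∈ S, ε n = -1 ∨ ε n = 1) ∧ x = ∑ n ∈ S, ε n * (n : ℝ) ^ δ

namespace IsSignedSum

variable {δ x y : ℝ} {S T : Finset ℕ}

theorem neg (h : IsSignedSum δ S x) : IsSignedSum δ S (-x) := by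
  obtain ⟨ε, hε, rfl⟩ := h
  refine ⟨fun n => -ε n, fun n hn => ?_, by simp [Finset.sum_neg_distrib]⟩
  rcases hε n hn with h | h <;> simp [h]

theorem add_union (hx : IsSignedSum δ S x) (hy : IsSignedSum δ T y) (hST : Disjoint S T) :
    IsSignedSum δ (S ∪ T) (x + y) := by
  obtain ⟨ε, hε, rfl⟩ := hx
  obtain ⟨η, hη, rfl⟩ := hy
  have hT : ∀ n ∈ T, n ∉ S := fun n hT hS => Finset.disjoint_left.mp hST hS hT
  refine ⟨fun n => if n ∈ S then ε n else η n, fun n hn => ?_, ?_⟩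
  · by_cases hS : n ∈ S
    · simpa [hS] using hε n hS
    · simpa [hS] using hη n ((Finset.mem_union.mp hn).resolve_left hS)
  · rw [Finset.sum_union hST]
    congr 1
    · exact Finset.sum_congr rfl fun n hn => by simp [hn]
    · exact Finset.sum_congr rfl fun n hn => by simp [hT n hn]

theorem add_Ico {a b c : ℕ} (hab : a ≤ b) (hbc : b ≤ c)
    (hx : IsSignedSum δ (Finset.Ico a b) x) (hy : IsSignedSum δ (Finset.Ico b c) y) :
    IsSignedSum δ (Finset.Ico a c) (x + y) := by
  rw [← Finset.Ico_union_Ico_eq_Ico hab hbc]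
  exact hx.add_union hy (Finset.Ico_disjoint_Ico_consecutive a b c)

theorem dyadicDiff_rpow (δ : ℝ) (j n : ℕ) :
    IsSignedSum δ (Finset.Ico n (n + 2 ^ j)) (dyadicDiff (fun x => x ^ δ) j n) := by
  induction j generalizing n with
  | zero => exact ⟨fun _ => 1, by simp, by simp [dyadicDiff]⟩
  | succ j ih =>
    have h := (ih n).neg.add_Ico (by simp) (by simp) (ih (n + 2 ^ j))
    have e : n + 2 ^ j + 2 ^ j = n + 2 ^ (j + 1) := by ring
    rw [e] at h
    convert h using 1
    simp [dyadicDiff]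
    ring

theorem sum_dyadicDiff_rpow (δ : ℝ) (k : ℕ) {N M : ℕ} (hNM : N ≤ M) :
    IsSignedSum δ (Finset.Ico (2 ^ k * (N + 1)) (2 ^ k * (M + 1)))
      (∑ m ∈ Finset.Ico N M, dyadicDiff (fun x => x ^ δ) k (2 ^ k * (m + 1))) := by
  induction M, hNM using Nat.le_induction with
  | base => exact ⟨fun _ => 1, by simp, by simp⟩
  | succ M hNM ih =>
    rw [Finset.sum_Ico_succ_top hNM]
    refine ih.add_Ico (by gcongr) (by gcongr; simp) ?_
    have h := dyadicDiff_rpow δ k (2 ^ k * (M + 1))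
    have e : 2 ^ k * (M + 1) + 2 ^ k = 2 ^ k * (M + 1 + 1) := by ring
    rw [e] at h
    simpa using h

end IsSignedSum

theorem hasDerivAt_dyadicDiff_rpow (δ : ℝ) (j : ℕ) {x : ℝ} (hx : 0 < x) :
    HasDerivAt (dyadicDiff (fun y => y ^ δ) j)
      (δ * dyadicDiff (fun y => y ^ (δ - 1)) j x) x := by
  induction j generalizing x with
  | zero => exact Real.hasDerivAt_rpow_const (Or.inl hx.ne')
  | succ j ih =>
    have h := ((ih (x := x + 2 ^ j) (by positivity)).comp_add_const x (2 ^ j)).sub (ih hx)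
    refine h.congr_deriv ?_
    simp only [dyadicDiff]
    ring

/-- An iterated difference of a power function equals an iterated derivative at a nearby point,
up to a nonzero constant. -/
theorem exists_dyadicDiff_rpow_eq (j : ℕ) (δ : ℝ) (hδ : ∀ i : ℕ, δ ≠ i) :
    ∃ C : ℝ, C ≠ 0 ∧ ∀ x : ℝ, 0 < x → ∃ ξ : ℝ, x ≤ ξ ∧ ξ ≤ x + (2 ^ j - 1) ∧
      dyadicDiff (fun y => y ^ δ) j x = C * ξ ^ (δ - j) := by
  induction j generalizing δ with
  | zero => exact ⟨1, one_ne_zero, fun x _ => ⟨x, le_rfl, by simp, by simp [dyadicDiff]⟩⟩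
  | succ j ih =>
    obtain ⟨C, hC, h⟩ := ih (δ - 1) fun i hi => hδ (i + 1) (by push_cast; linarith)
    have hδ0 : δ ≠ 0 := by simpa using hδ 0
    refine ⟨2 ^ j * δ * C, by positivity, fun x hx => ?_⟩
    have hpow : (0 : ℝ) < 2 ^ j := by positivity
    obtain ⟨η, ⟨hη₁, hη₂⟩, hη⟩ := exists_hasDerivAt_eq_slope (dyadicDiff (fun y => y ^ δ) j)
      (fun x => δ * dyadicDiff (fun y => y ^ (δ - 1)) j x) (lt_add_of_pos_right x hpow)
      (fun y hy => (hasDerivAt_dyadicDiff_rpow δ j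
        (hx.trans_le hy.1)).continuousAt.continuousWithinAt)
      (fun y hy => hasDerivAt_dyadicDiff_rpow δ j (hx.trans hy.1))
    obtain ⟨ξ, hξ₁, hξ₂, hξ⟩ := h η (hx.trans hη₁)
    refine ⟨ξ, hη₁.le.trans hξ₁, by rw [pow_succ]; linarith, ?_⟩
    rw [add_sub_cancel_left, eq_div_iff hpow.ne'] at hη
    rw [dyadicDiff, ← hη, hξ]
    push_cast
    rw [show δ - 1 - j = δ - (j + 1) by ring]
    ring

/-- If positive terms tend to zero and are not summable, sums over blocks of consecutive terms
approximate every nonnegative real. -/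
theorem exists_sum_Ico_near {a : ℕ → ℝ} (ha : ∀ m, 0 ≤ a m)
    (hlim : Filter.Tendsto a Filter.atTop (nhds 0)) (hsum : ¬Summable a)
    {x r : ℝ} (hx : 0 ≤ x) (hr : 0 < r) :
    ∃ N M, N ≤ M ∧ |∑ m ∈ Finset.Ico N M, a m - x| < r := by
  obtain ⟨N, hN⟩ := Filter.eventually_atTop.mp (hlim.eventually_lt_const hr)
  have hdiv := (not_summable_iff_tendsto_nat_atTop_of_nonneg ha).mp hsum
  have hex : ∃ M, x < ∑ m ∈ Finset.Ico N (N + M), a m := by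
    obtain ⟨M, hM, hNM⟩ := ((hdiv.eventually_gt_atTop
      (x + ∑ m ∈ Finset.range N, a m)).and (Filter.eventually_ge_atTop N)).exists
    refine ⟨M - N, ?_⟩
    rw [Nat.add_sub_cancel' hNM, Finset.sum_Ico_eq_sub _ hNM]
    linarith
  classical
  have hspec := Nat.find_spec hex
  have hmin := fun m => @Nat.find_min _ _ hex m
  generalize Nat.find hex = M at hspec hmin
  cases M with
  | zero => simp at hspec; linarith
  | succ M =>
    have h₁ := hmin M (Nat.lt_succ_self M)
    have h₂ := hN (N + M) (by simp)
    rw [← add_assoc, Finset.sum_Ico_succ_top (by simp)] at hspec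
    exact ⟨N, N + M, by simp, by rw [abs_lt]; constructor <;> linarith⟩

theorem exists_isSignedSum_near {δ : ℝ} (hδ : ∀ i : ℕ, δ ≠ i) (hδ₁ : -1 ≤ δ) (x : ℝ)
    {r : ℝ} (hr : 0 < r) :
    ∃ S : Finset ℕ, (∀ n ∈ S, 1 ≤ n) ∧ ∃ y, IsSignedSum δ S y ∧ |y - x| < r := by
  obtain ⟨k, hk₁, hk₂⟩ : ∃ k : ℕ, -1 ≤ δ - k ∧ δ - k < 0 :=
    ⟨⌊δ + 1⌋₊, by linarith [Nat.floor_le (show 0 ≤ δ + 1 by linarith)],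
      by linarith [Nat.lt_floor_add_one (δ + 1)]⟩
  obtain ⟨C, hC, h⟩ := exists_dyadicDiff_rpow_eq k δ hδ
  have hpow : (0 : ℝ) < 2 ^ k := by positivity
  choose ξ hξ₁ hξ₂ hξ using fun m : ℕ => h (2 ^ k * (m + 1)) (by positivity)
  have hξpos : ∀ m, 0 < ξ m := fun m =>
    lt_of_lt_of_le (show (0 : ℝ) < 2 ^ k * (m + 1) by positivity) (hξ₁ m)
  have hξtop : Filter.Tendsto ξ Filter.atTop Filter.atTop := by
    refine Filter.tendsto_atTop_mono (fun m => ?_) tendsto_natCast_atTop_atTop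
    have : (1 : ℝ) ≤ 2 ^ k := one_le_pow₀ (by norm_num)
    nlinarith [hξ₁ m, (Nat.cast_nonneg m : (0 : ℝ) ≤ m)]
  have hlim : Filter.Tendsto (fun m => ξ m ^ (δ - k)) Filter.atTop (nhds 0) := by
    have := (tendsto_rpow_neg_atTop (neg_pos.mpr hk₂)).comp hξtop
    simpa [Function.comp_def] using this
  have hsum : ¬Summable fun m => ξ m ^ (δ - k) := by
    intro hs
    have hs' : Summable fun m : ℕ => (2 ^ k : ℝ) ^ (δ - k) * ((m + 2 : ℕ) : ℝ) ^ (δ - k) := by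
      refine hs.of_nonneg_of_le (fun m => by positivity) fun m => ?_
      rw [← Real.mul_rpow hpow.le (Nat.cast_nonneg _)]
      refine Real.rpow_le_rpow_of_nonpos (hξpos m) ?_ hk₂.le
      push_cast
      linarith [hξ₂ m]
    rw [summable_mul_left_iff (by positivity),
      summable_nat_add_iff (f := fun n : ℕ => (n : ℝ) ^ (δ - k)) 2, Real.summable_nat_rpow] at hs'
    linarith
  have key : ∀ z : ℝ, 0 ≤ z → ∃ S : Finset ℕ, (∀ n ∈ S, 1 ≤ n) ∧
      ∃ y, IsSignedSum δ S y ∧ |y - C * z| < r := by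
    intro z hz
    obtain ⟨N, M, hNM, hnear⟩ := exists_sum_Ico_near (fun m => by have := hξpos m; positivity)
      hlim hsum hz (div_pos hr (abs_pos.mpr hC))
    refine ⟨_, fun n hn => ?_, _, IsSignedSum.sum_dyadicDiff_rpow δ k hNM, ?_⟩
    · exact le_trans (Nat.succ_le_of_lt (by positivity)) (Finset.mem_Ico.mp hn).1
    · simp_rw [hξ]
      rw [← Finset.mul_sum, ← mul_sub, abs_mul, mul_comm]
      exact (lt_div_iff₀ (abs_pos.mpr hC)).mp hnear
  rcases le_total 0 (x / C) with hz | hz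
  · simpa [mul_div_cancel₀ x hC] using key _ hz
  · obtain ⟨S, hS, y, hy, hyr⟩ := key (-(x / C)) (neg_nonneg.mpr hz)
    refine ⟨S, hS, -y, hy.neg, ?_⟩
    rw [mul_neg, mul_div_cancel₀ x hC] at hyr
    rw [← abs_neg]
    convert hyr using 2
    ring

/-- Signed sums of the terms of a summable sequence are bounded. -/
theorem abs_signedSum_le_tsum {f ε : ℕ → ℝ} (hf : Summable f) (hf₀ : ∀ n, 0 ≤ f n)
    {S : Finset ℕ} (hε : ∀ n ∈ S, ε n = -1 ∨ ε n = 1) :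
    |∑ n ∈ S, ε n * f n| ≤ ∑' n, f n := by
  refine (Finset.abs_sum_le_sum_abs _ _).trans (le_trans (Finset.sum_le_sum fun n hn => ?_)
    (hf.sum_le_tsum S fun n _ => hf₀ n))
  rcases hε n hn with h | h <;> simp [h, abs_of_nonneg (hf₀ n)]

/-- Signed sums of integer powers with natural exponent are integers. -/
theorem exists_int_eq_signedSum_pow (d : ℕ) {ε : ℕ → ℝ} {S : Finset ℕ}
    (hε : ∀ n ∈ S, ε n = -1 ∨ ε n = 1) :
    ∃ z : ℤ, ∑ n ∈ S, ε n * (n : ℝ) ^ d = z := by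
  have : ∑ n ∈ S, ε n * (n : ℝ) ^ d ∈ (Int.castRingHom ℝ).range := by
    refine Subring.sum_mem _ fun n hn => Subring.mul_mem _ ?_ (pow_mem (natCast_mem _ n) d)
    rcases hε n hn with h | h <;> rw [h]
    · exact neg_mem (one_mem _)
    · exact one_mem _
  obtain ⟨z, hz⟩ := this
  exact ⟨z, hz.symm⟩

/-- the sequence `⟨n^δ : n ≥ 1⟩` (real power) is dense-expandable
iff `δ = -1`, or `δ > -1` and `δ` is not an integer. -/
theorem rpow_sequence_dense_expandable_iff (δ : ℝ) :
    Dense {x : ℝ | ∃ S : Finset ℕ, (∀ n ∈ S, 1 ≤ n) ∧ ∃ ε : ℕ → ℝ,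
        (∀ n ∈ S, ε n = -1 ∨ ε n = 1) ∧ x = ∑ n ∈ S, ε n * (n : ℝ) ^ δ} ↔
      (δ = -1 ∨ (-1 < δ ∧ ¬∃ z : ℤ, δ = (z : ℝ))) := by
  constructor
  · intro hd
    rcases lt_trichotomy δ (-1) with hlt | heq | hgt
    · obtain ⟨_, ⟨S, -, ε, hε, rfl⟩, hx⟩ := hd.exists_gt (∑' n : ℕ, (n : ℝ) ^ δ)
      have := abs_signedSum_le_tsum (Real.summable_nat_rpow.mpr hlt) (fun n => by positivity) hε
      exact absurd hx (not_lt.mpr ((le_abs_self _).trans this))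
    · exact Or.inl heq
    · refine Or.inr ⟨hgt, ?_⟩
      rintro ⟨z, rfl⟩
      have hz : -1 < z := by exact_mod_cast hgt
      lift z to ℕ using by omega
      obtain ⟨_, ⟨S, -, ε, hε, rfl⟩, h₀, h₁⟩ := hd.exists_between (zero_lt_one' ℝ)
      simp only [Int.cast_natCast, Real.rpow_natCast] at h₀ h₁
      obtain ⟨w, hw⟩ := exists_int_eq_signedSum_pow z hε
      rw [hw] at h₀ h₁
      have h₀' : 0 < w := by exact_mod_cast h₀
      have h₁' : w < 1 := by exact_mod_cast h₁
      omega
  · intro h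
    have hδ₁ : -1 ≤ δ := h.elim (fun h => h.ge) fun h => h.1.le
    have hδ : ∀ i : ℕ, δ ≠ i := by
      rintro i rfl
      rcases h with h | h
      · linarith [(Nat.cast_nonneg i : (0 : ℝ) ≤ i)]
      · exact h.2 ⟨i, by simp⟩
    refine Metric.dense_iff.mpr fun x r hr => ?_
    obtain ⟨S, hS, y, ⟨ε, hε, hy⟩, hyr⟩ := exists_isSignedSum_near hδ hδ₁ x hr
    exact ⟨y, by simpa [Real.dist_eq] using hyr, S, hS, ε, hε, hy⟩
end

section
/- Assume the Riemann hypothesis. Let ⟨p_n : n ∈ ℕ⟩ be the increasing sequence of all prime numbers and let 0 < δ < 1/2. Then the sequence E = ⟨p_n^δ : n ∈ ℕ⟩ is dense-expandable, i.e., the set of all finite signed sums ∑_{n∈S} ε_n p_n^δ, with S ⊆ ℕ finite and ε_n ∈ {-1,1}, is dense in ℝ. -/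
/-- The difference of the `δ`-th powers of two naturals `a < b` is at least `δ / b`. -/
theorem div_le_rpow_sub_rpow {a b : ℕ} (hab : a < b) {δ : ℝ} (h0 : 0 < δ) (h1 : δ ≤ 1) :
    δ * (1 / (b : ℝ)) ≤ (b : ℝ) ^ δ - (a : ℝ) ^ δ := by
  have hb : (1 : ℝ) ≤ b := by exact_mod_cast (by omega : 1 ≤ b)
  have hb0 : (0 : ℝ) < b := by linarith
  have hab' : (a : ℝ) + 1 ≤ b := by exact_mod_cast hab
  have hinv : 1 / (b : ℝ) ≤ 1 := by rw [div_le_one hb0]; exact hb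
  have hle : (a : ℝ) ≤ b * (1 + -(1 / (b : ℝ))) := by
    have : (b : ℝ) * (1 + -(1 / (b : ℝ))) = b - 1 := by field_simp; ring
    linarith
  have hpow : (a : ℝ) ^ δ ≤ (b : ℝ) ^ δ * (1 + -(1 / (b : ℝ))) ^ δ := by
    rw [← Real.mul_rpow hb0.le (by linarith)]
    exact Real.rpow_le_rpow (Nat.cast_nonneg a) hle h0.le
  have hbern := rpow_one_add_le_one_add_mul_self (s := -(1 / (b : ℝ))) (by linarith) h0.le h1
  have hbd : (1 : ℝ) ≤ (b : ℝ) ^ δ := Real.one_le_rpow hb h0.le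
  have hnn : 0 ≤ δ * (1 / (b : ℝ)) := by positivity
  nlinarith [mul_le_mul_of_nonneg_left hbern (by linarith : (0 : ℝ) ≤ (b : ℝ) ^ δ)]

/-- If `0 < a < b` and the difference of the `δ`-th powers is at least `η`, then `1 / b` is
controlled by the difference of the `(-δ)`-th powers. -/
theorem mul_one_div_le_inv_rpow_sub_inv_rpow {a b : ℕ} (ha : 0 < a) (hab : a < b) {δ η : ℝ}
    (h0 : 0 < δ) (h1 : δ < 1 / 2) (hη : 0 < η) (h : η ≤ (b : ℝ) ^ δ - (a : ℝ) ^ δ) :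
    η * (1 / (b : ℝ)) ≤ ((a : ℝ) ^ δ)⁻¹ - ((b : ℝ) ^ δ)⁻¹ := by
  have ha0 : (0 : ℝ) < a := by exact_mod_cast ha
  have hb : (1 : ℝ) ≤ b := by exact_mod_cast (by omega : 1 ≤ b)
  have hb0 : (0 : ℝ) < b := by linarith
  have hA : 0 < (a : ℝ) ^ δ := Real.rpow_pos_of_pos ha0 δ
  have hB : 0 < (b : ℝ) ^ δ := Real.rpow_pos_of_pos hb0 δ
  have hprod : (a : ℝ) ^ δ * (b : ℝ) ^ δ ≤ b := by
    calc (a : ℝ) ^ δ * (b : ℝ) ^ δ ≤ (b : ℝ) ^ δ * (b : ℝ) ^ δ := by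
          gcongr
      _ = (b : ℝ) ^ (δ + δ) := (Real.rpow_add hb0 δ δ).symm
      _ ≤ (b : ℝ) ^ (1 : ℝ) := Real.rpow_le_rpow_of_exponent_le hb (by linarith)
      _ = b := Real.rpow_one _
  rw [inv_sub_inv hA.ne' hB.ne', mul_one_div]
  exact div_le_div₀ (by linarith) h (by positivity) hprod

/-- The sum of the reciprocals of the oddly indexed primes diverges. -/
theorem not_summable_one_div_nth_prime_odd :
    ¬ Summable fun k : ℕ => 1 / (Nat.nth Nat.Prime (2 * k + 1) : ℝ) := by
  intro h
  have hmono := Nat.nth_strictMono Nat.infinite_setOfPred_prime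
  have heven : Summable fun k : ℕ => 1 / (Nat.nth Nat.Prime (2 * k) : ℝ) := by
    rw [← summable_nat_add_iff 1]
    refine h.of_nonneg_of_le (fun k => by positivity) fun k => ?_
    have hpos : (0 : ℝ) < Nat.nth Nat.Prime (2 * k + 1) := by
      exact_mod_cast (Nat.prime_nth_prime _).pos
    refine one_div_le_one_div_of_le hpos ?_
    exact_mod_cast hmono.monotone (by omega)
  have hall : Summable fun n : ℕ => 1 / (Nat.nth Nat.Prime n : ℝ) :=
    (HasSum.even_add_odd (f := fun n : ℕ => 1 / (Nat.nth Nat.Prime n : ℝ))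
      heven.hasSum h.hasSum).summable
  refine not_summable_one_div_on_primes ?_
  have hrange : Set.range (Nat.nth Nat.Prime) = {p | Nat.Prime p} :=
    Nat.range_nth_of_infinite Nat.infinite_setOfPred_prime
  rw [← hmono.injective.summable_iff]
  · refine hall.congr fun n => ?_
    simp [Set.indicator, Nat.prime_nth_prime]
  · intro x hx
    rw [hrange] at hx
    exact Set.indicator_of_notMem hx _

/-- For every `η > 0`, the differences of `δ`-th powers of paired consecutive primes that are
smaller than `η` have a divergent sum. -/
theorem not_summable_small_rpow_prime_differences {δ η : ℝ} (h0 : 0 < δ) (h1 : δ < 1 / 2)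
    (hη : 0 < η) {E : ℕ → ℝ} (hE : ∀ n, E n = (Nat.nth Nat.Prime n : ℝ) ^ δ) :
    ¬ Summable fun k : ℕ =>
      if E (2 * k + 1) - E (2 * k) < η then E (2 * k + 1) - E (2 * k) else 0 := by
  intro hs
  have hmono := Nat.nth_strictMono Nat.infinite_setOfPred_prime
  have hlt : ∀ n, Nat.nth Nat.Prime n < Nat.nth Nat.Prime (n + 1) := fun n =>
    hmono (Nat.lt_succ_self n)
  have hpos : ∀ n, 0 < E n := fun n => by
    rw [hE]
    exact Real.rpow_pos_of_pos (by exact_mod_cast (Nat.prime_nth_prime n).pos) δ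
  have hEle : ∀ n, E n ≤ E (n + 1) := fun n => by
    rw [hE, hE]
    exact Real.rpow_le_rpow (Nat.cast_nonneg _) (by exact_mod_cast (hlt n).le) h0.le
  have hinv : ∀ n, (E (n + 1))⁻¹ ≤ (E n)⁻¹ := fun n => inv_anti₀ (hpos n) (hEle n)
  have htel : Summable fun k : ℕ => (E (2 * k))⁻¹ - (E (2 * k + 1))⁻¹ := by
    refine summable_of_sum_range_le (c := (E 0)⁻¹) (fun k => sub_nonneg.2 (hinv _)) fun n => ?_
    have hbound : ∑ k ∈ Finset.range n, ((E (2 * k))⁻¹ - (E (2 * k + 1))⁻¹)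
        ≤ (E 0)⁻¹ - (E (2 * n))⁻¹ := by
      induction n with
      | zero => simp
      | succ n ih =>
        rw [Finset.sum_range_succ]
        have := hinv (2 * n + 1)
        rw [show 2 * (n + 1) = 2 * n + 1 + 1 by ring]
        linarith
    have := inv_pos.2 (hpos (2 * n))
    linarith
  refine not_summable_one_div_nth_prime_odd ?_
  refine ((hs.mul_left δ⁻¹).add (htel.mul_left η⁻¹)).of_nonneg_of_le
    (fun k => by positivity) fun k => ?_
  have hsub := sub_nonneg.2 (hinv (2 * k))
  split_ifs with h
  · have hd := div_le_rpow_sub_rpow (hlt (2 * k)) h0 (by linarith)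
    rw [← hE, ← hE, ← le_inv_mul_iff₀ h0] at hd
    have : 0 ≤ η⁻¹ * ((E (2 * k))⁻¹ - (E (2 * k + 1))⁻¹) :=
      mul_nonneg (inv_pos.2 hη).le hsub
    linarith
  · rw [not_lt, hE, hE] at h
    have hd := mul_one_div_le_inv_rpow_sub_inv_rpow (Nat.prime_nth_prime _).pos
      (hlt (2 * k)) h0 h1 hη h
    rw [← hE, ← hE, ← le_inv_mul_iff₀ hη] at hd
    linarith

/-- A real sequence starting at `0`, unbounded above and with increments smaller than `η`
comes within `η` of every nonnegative real. -/
theorem exists_abs_sub_lt_of_increment_lt {s : ℕ → ℝ} {η t : ℝ} (hs0 : s 0 = 0)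
    (hs : ∀ n, s (n + 1) < s n + η) (hunb : ∃ n, t < s n) (ht : 0 ≤ t) :
    ∃ n, |s n - t| < η := by
  classical
  have hN := Nat.find_spec hunb
  have hmin := fun m => Nat.find_min hunb (m := m)
  rcases hfind : Nat.find hunb with _ | n
  · rw [hfind, hs0] at hN
    linarith
  · have hle : s n ≤ t := not_lt.1 (hmin n (by omega))
    rw [hfind] at hN
    have := hs n
    exact ⟨n + 1, by rw [abs_lt]; constructor <;> linarith⟩

/-- If for every `η > 0` the differences `E (2k+1) - E (2k)` lying in `[0, η)` have a divergent
sum, then the finite signed sums of `E` are dense. -/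
theorem dense_signed_sums_of_not_summable {E : ℕ → ℝ} (hE : ∀ k, E (2 * k) ≤ E (2 * k + 1))
    (hdiv : ∀ η : ℝ, 0 < η → ¬ Summable fun k : ℕ =>
      if E (2 * k + 1) - E (2 * k) < η then E (2 * k + 1) - E (2 * k) else 0) :
    Dense {x : ℝ | ∃ S : Finset ℕ, ∃ ε : ℕ → ℝ,
      (∀ n ∈ S, ε n = -1 ∨ ε n = 1) ∧ x = ∑ n ∈ S, ε n * E n} := by
  classical
  rw [Metric.dense_iff]
  intro t η hη
  set g : ℕ → ℝ := fun k =>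
    if E (2 * k + 1) - E (2 * k) < η then E (2 * k + 1) - E (2 * k) else 0 with hg
  have hg0 : ∀ k, 0 ≤ g k := fun k => by
    simp only [hg]
    split_ifs
    · exact sub_nonneg.2 (hE k)
    · exact le_rfl
  have hglt : ∀ k, g k < η := fun k => by
    simp only [hg]
    split_ifs with h
    · exact h
    · exact hη
  have htend := (not_summable_iff_tendsto_nat_atTop_of_nonneg hg0).1 (hdiv η hη)
  obtain ⟨N, hN⟩ := exists_abs_sub_lt_of_increment_lt
    (s := fun n => ∑ k ∈ Finset.range n, g k) (η := η) (t := |t|) (by simp)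
    (fun n => by rw [Finset.sum_range_succ]; linarith [hglt n])
    ((htend.eventually_gt_atTop |t|).exists) (abs_nonneg t)
  have hrep : ∀ N : ℕ, ∑ n ∈ (Finset.range (2 * N)).filter
      (fun n => E (2 * (n / 2) + 1) - E (2 * (n / 2)) < η), (-1 : ℝ) ^ (n + 1) * E n
      = ∑ k ∈ Finset.range N, g k := by
    intro N
    rw [Finset.sum_filter]
    induction N with
    | zero => simp
    | succ N ih =>
      rw [show 2 * (N + 1) = 2 * N + 1 + 1 by ring, Finset.sum_range_succ, Finset.sum_range_succ,
        Finset.sum_range_succ, ih, show (2 * N + 1) / 2 = N by omega,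
        show 2 * N / 2 = N by omega]
      simp only [hg]
      split_ifs
      · have hsign : (-1 : ℝ) ^ (2 * N) = 1 := by rw [pow_mul]; norm_num
        simp only [pow_succ, hsign]
        ring
      · ring
  obtain ⟨c, hc, hct⟩ : ∃ c : ℝ, (c = -1 ∨ c = 1) ∧ t = c * |t| := by
    rcases le_total 0 t with h | h
    · exact ⟨1, Or.inr rfl, by rw [abs_of_nonneg h, one_mul]⟩
    · exact ⟨-1, Or.inl rfl, by rw [abs_of_nonpos h]; ring⟩
  have hcabs : |c| = 1 := by rcases hc with rfl | rfl <;> simp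
  refine ⟨c * ∑ k ∈ Finset.range N, g k, ?_, (Finset.range (2 * N)).filter
    (fun n => E (2 * (n / 2) + 1) - E (2 * (n / 2)) < η), fun n => c * (-1) ^ (n + 1), ?_, ?_⟩
  · rw [Metric.mem_ball, Real.dist_eq]
    nth_rewrite 1 [hct]
    rw [← mul_sub, abs_mul, hcabs, one_mul]
    exact hN
  · intro n _
    rcases hc with rfl | rfl <;> rcases neg_one_pow_eq_or ℝ (n + 1) with h | h <;> simp [h]
  · rw [← hrep N, Finset.mul_sum]
    exact Finset.sum_congr rfl fun n _ => by ring


/-- assuming the Riemann hypothesis, for every `0 < δ < 1/2` the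
sequence `⟨p_n^δ⟩` of `δ`-th powers of the primes (in increasing order) is
dense-expandable: the set of finite signed sums `∑_{n∈S} ε_n p_n^δ` is dense
in `ℝ`. -/
theorem prime_rpow_dense_expandable_of_RH (hRH : RiemannHypothesis)
    (δ : ℝ) (hδ₁ : 0 < δ) (hδ₂ : δ < 1 / 2) :
    Dense {x : ℝ | ∃ S : Finset ℕ, ∃ ε : ℕ → ℝ,
      (∀ n ∈ S, ε n = -1 ∨ ε n = 1) ∧
      x = ∑ n ∈ S, ε n * (Nat.nth Nat.Prime n : ℝ) ^ δ} := by
  refine dense_signed_sums_of_not_summable (E := fun n => (Nat.nth Nat.Prime n : ℝ) ^ δ)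
    (fun k => ?_) fun η hη => not_summable_small_rpow_prime_differences hδ₁ hδ₂ hη
      (E := fun n => (Nat.nth Nat.Prime n : ℝ) ^ δ) fun _ => rfl
  have hle : Nat.nth Nat.Prime (2 * k) ≤ Nat.nth Nat.Prime (2 * k + 1) :=
    (Nat.nth_strictMono Nat.infinite_setOfPred_prime).monotone (Nat.le_succ (2 * k))
  exact Real.rpow_le_rpow (Nat.cast_nonneg _) (Nat.cast_le.2 hle) hδ₁.le
end

section
/- Let ⟨p_n : n ∈ ℕ⟩ be the increasing sequence of all prime numbers and assume that √(p_{n+1}) - √(p_n) → 0 as n → ∞. Then for every δ with 0 < δ ≤ 1/2, the sequence E = ⟨p_n^δ : n ∈ ℕ⟩ is dense-expandable, i.e., the set of all finite signed sums ∑_{n∈S} ε_n p_n^δ, with S ⊆ ℕ finite and ε_n ∈ {-1,1}, is dense in ℝ. -/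
open Filter

/-- If `f → ∞` with steps tending to zero, then every `x ≥ 0` is approximated by sums of
consecutive disjoint differences of `f`. -/
lemma exists_sum_disjoint_differences_near {f : ℕ → ℝ} (hf : Tendsto f atTop atTop)
    (hd : Tendsto (fun n => f (n + 1) - f n) atTop (nhds 0)) {x η : ℝ} (hx : 0 ≤ x)
    (hη : 0 < η) :
    ∃ M K : ℕ, |∑ k ∈ Finset.range K, (f (M + 2 * k + 1) - f (M + 2 * k)) - x| < η := by
  classical
  obtain ⟨N, hN⟩ := Metric.tendsto_atTop.1 hd η hη
  have hsum : ∀ K, ∑ k ∈ Finset.range K, (f (N + 2 * k + 1) - f (N + 2 * k)) +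
      ∑ k ∈ Finset.range K, (f (N + 1 + 2 * k + 1) - f (N + 1 + 2 * k)) =
        f (N + 2 * K) - f N := by
    intro K
    induction K with
    | zero => simp
    | succ K ih =>
      rw [Finset.sum_range_succ, Finset.sum_range_succ,
        show N + 2 * (K + 1) = N + 1 + 2 * K + 1 by ring, show N + 1 + 2 * K = N + 2 * K + 1 by ring]
      linarith
  obtain ⟨M, hM, hex⟩ : ∃ M ≥ N, ∃ K,
      x < ∑ k ∈ Finset.range K, (f (M + 2 * k + 1) - f (M + 2 * k)) := by
    obtain ⟨L, hL⟩ := (tendsto_atTop.1 hf (f N + 2 * x + 1)).exists_forall_of_atTop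
    by_contra! h
    linarith [h N le_rfl L, h (N + 1) (Nat.le_succ N) L, hsum L, hL (N + 2 * L) (by omega)]
  refine ⟨M, Nat.find hex, ?_⟩
  have hgt := Nat.find_spec hex
  obtain ⟨K, hK⟩ : ∃ K, Nat.find hex = K + 1 := by
    refine Nat.exists_eq_succ_of_ne_zero fun h => ?_
    rw [h] at hgt
    simp at hgt
    linarith
  have hle := not_lt.1 (Nat.find_min hex (m := K) (by omega))
  rw [hK, Finset.sum_range_succ] at hgt ⊢
  have hstep := hN (M + 2 * K) (by omega)
  rw [Real.dist_eq, sub_zero] at hstep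
  rw [abs_lt] at hstep ⊢
  constructor <;> linarith

lemma sum_Ico_alternating_eq_sum_differences (f : ℕ → ℝ) (M K : ℕ) :
    ∑ n ∈ Finset.Ico M (M + 2 * K), (-1) ^ (n - M + 1) * f n =
      ∑ k ∈ Finset.range K, (f (M + 2 * k + 1) - f (M + 2 * k)) := by
  simp only [Finset.sum_Ico_eq_sum_range, Nat.add_sub_cancel_left]
  induction K with
  | zero => simp
  | succ K ih =>
    rw [show 2 * (K + 1) = 2 * K + 1 + 1 by ring, Finset.sum_range_succ, Finset.sum_range_succ, ih,
      Finset.sum_range_succ]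
    simp [pow_succ, pow_mul, ← add_assoc]
    ring

/-- Signed finite sums of a sequence tending to infinity with steps tending to zero are dense. -/
lemma dense_signed_sums_of_tendsto {f : ℕ → ℝ} (hf : Tendsto f atTop atTop)
    (hd : Tendsto (fun n => f (n + 1) - f n) atTop (nhds 0)) :
    Dense {x : ℝ | ∃ S : Finset ℕ, ∃ ε : ℕ → ℝ,
      (∀ n ∈ S, ε n = -1 ∨ ε n = 1) ∧ x = ∑ n ∈ S, ε n * f n} := by
  rw [Metric.dense_iff]
  intro x η hη
  obtain ⟨M, K, h⟩ := exists_sum_disjoint_differences_near hf hd (abs_nonneg x) hη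
  rw [← sum_Ico_alternating_eq_sum_differences] at h
  rcases abs_choice x with hx | hx
  · refine ⟨_, ?_, Finset.Ico M (M + 2 * K), fun n => (-1) ^ (n - M + 1),
      fun n _ => (neg_one_pow_eq_or ℝ _).symm, rfl⟩
    rwa [Metric.mem_ball, Real.dist_eq, ← hx]
  · refine ⟨_, ?_, Finset.Ico M (M + 2 * K), fun n => -(-1) ^ (n - M + 1),
      fun n _ => ?_, rfl⟩
    · rw [Metric.mem_ball, Real.dist_eq, ← abs_neg]
      rw [hx] at h
      convert h using 2
      simp only [neg_mul, Finset.sum_neg_distrib]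
      ring
    · rcases neg_one_pow_eq_or ℝ (n - M + 1) with h1 | h1 <;> simp [h1]

lemma Real.rpow_sub_rpow_le_of_one_le {a b c d : ℝ} (hb : 1 ≤ b) (hab : b ≤ a) (hc : 0 ≤ c)
    (hcd : c ≤ d) : a ^ c - b ^ c ≤ a ^ d - b ^ d := by
  have hb0 : 0 < b := by linarith
  have hr : 1 ≤ a / b := (one_le_div hb0).2 hab
  have key : ∀ e : ℝ, a ^ e - b ^ e = b ^ e * ((a / b) ^ e - 1) := fun e => by
    rw [Real.div_rpow (by linarith) hb0.le]
    field_simp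
  rw [key, key]
  have h1 := Real.one_le_rpow hr hc
  exact mul_le_mul (Real.rpow_le_rpow_of_exponent_le hb hcd)
    (by linarith [Real.rpow_le_rpow_of_exponent_le hr hcd]) (by linarith) (by positivity)

/-- if `√p_{n+1} - √p_n → 0` (where `⟨p_n⟩` is the increasing
sequence of primes), then for every `0 < δ ≤ 1/2` the sequence `⟨p_n^δ⟩` is
dense-expandable: the set of finite signed sums `∑_{n∈S} ε_n p_n^δ` is dense
in `ℝ`. -/
theorem prime_rpow_dense_expandable_of_sqrt_gap
    (hgap : Tendsto (fun n => Real.sqrt (Nat.nth Nat.Prime (n + 1)) -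
      Real.sqrt (Nat.nth Nat.Prime n)) atTop (nhds 0))
    (δ : ℝ) (hδ₁ : 0 < δ) (hδ₂ : δ ≤ 1 / 2) :
    Dense {x : ℝ | ∃ S : Finset ℕ, ∃ ε : ℕ → ℝ,
      (∀ n ∈ S, ε n = -1 ∨ ε n = 1) ∧
      x = ∑ n ∈ S, ε n * (Nat.nth Nat.Prime n : ℝ) ^ δ} := by
  have hmono : StrictMono (Nat.nth Nat.Prime) := Nat.nth_strictMono Nat.infinite_setOfPred_prime
  have hle (n : ℕ) : (Nat.nth Nat.Prime n : ℝ) ≤ Nat.nth Nat.Prime (n + 1) :=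
    Nat.cast_le.2 (hmono (Nat.lt_succ_self n)).le
  refine dense_signed_sums_of_tendsto (f := fun n => (Nat.nth Nat.Prime n : ℝ) ^ δ)
    ((tendsto_rpow_atTop hδ₁).comp (tendsto_natCast_atTop_atTop.comp hmono.tendsto_atTop))
    (squeeze_zero (fun n => ?_) (fun n => ?_) hgap)
  · exact sub_nonneg.2 (Real.rpow_le_rpow (Nat.cast_nonneg _) (hle n) hδ₁.le)
  · rw [Real.sqrt_eq_rpow, Real.sqrt_eq_rpow]
    exact Real.rpow_sub_rpow_le_of_one_le
      (Nat.one_le_cast.2 (Nat.prime_nth_prime n).one_lt.le) (hle n) hδ₁.le hδ₂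
end

section
/- Let n ≥ 2 and let P_n = ⟨a_0, …, a_k⟩ be the n-th P-sequence. Define Q_n = ⟨b_0, …, b_{k+2}⟩ by b_i = a_i for i ∈ {0,1} and b_i = a_{i-2} for i ∈ {k+1,k+2}, and b_i = a_i + a_{i-2} otherwise. Then each b_i ∈ {-1,0,1}, Q_n has the same number of entries 1 as entries -1, and the sets U = {i+1 : b_i = 1} and V = {i+1 : b_i = -1} are disjoint subsets of ℕ of equal cardinality satisfying ∑_{u∈U} u^s = ∑_{v∈V} v^s for every s = 0, …, n-1. -/
/-- The invariants of the P-sequences: `f` is supported on `[0, L)`, starts with `1, -1`, is symmetric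
(`ε = 1`) or antisymmetric (`ε = -1`), has entries and distance-two sums in `{-1, 0, 1}`, and its
first `n` power moments vanish. -/
structure IsPSequence (n : ℕ) (f : ℕ → ℤ) (L : ℕ) (ε : ℤ) : Prop where
  two_le : 2 ≤ L
  eq_zero : ∀ i, L ≤ i → f i = 0
  reflect : ∀ i, i < L → f (L - 1 - i) = ε * f i
  zero : f 0 = 1
  one : f 1 = -1
  bound : ∀ i, |f i| ≤ 1
  bound_add : ∀ i, |f i + f (i + 2)| ≤ 1
  moment : ∀ s < n, ∑ i ∈ Finset.range L, f i * (i : ℤ) ^ s = 0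

/-- The sequence `f` delayed by `m` positions. -/
def delay (m : ℕ) (f : ℕ → ℤ) (i : ℕ) : ℤ := if m ≤ i then f (i - m) else 0

theorem sum_delay_mul (m L : ℕ) (f w : ℕ → ℤ) :
    ∑ i ∈ Finset.range (L + m), delay m f i * w i = ∑ i ∈ Finset.range L, f i * w (i + m) := by
  rw [add_comm L m, Finset.sum_range_add, Finset.sum_eq_zero, zero_add]
  · refine Finset.sum_congr rfl fun i _ => ?_
    simp [delay, add_comm]
  · intro i hi
    simp [delay, Nat.not_le.2 (Finset.mem_range.1 hi)]

theorem sum_range_add_eq_of_eq_zero {f : ℕ → ℤ} {L : ℕ} (h : ∀ i, L ≤ i → f i = 0) (m : ℕ)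
    (w : ℕ → ℤ) :
    ∑ i ∈ Finset.range (L + m), f i * w i = ∑ i ∈ Finset.range L, f i * w i := by
  rw [Finset.sum_range_add, add_eq_left]
  exact Finset.sum_eq_zero fun i _ => by rw [h _ (Nat.le_add_right L i), zero_mul]

theorem sum_mul_add_pow_eq {n L : ℕ} {f : ℕ → ℤ}
    (h : ∀ s < n, ∑ i ∈ Finset.range L, f i * (i : ℤ) ^ s = 0) (c : ℤ) {s : ℕ} (hs : s ≤ n) :
    ∑ i ∈ Finset.range L, f i * ((i : ℤ) + c) ^ s = ∑ i ∈ Finset.range L, f i * (i : ℤ) ^ s := by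
  simp only [add_pow, Finset.mul_sum]
  rw [Finset.sum_comm, Finset.sum_range_succ, Finset.sum_eq_zero, zero_add]
  · simp
  · intro j hj
    have hj' := h j ((Finset.mem_range.1 hj).trans_le hs)
    calc _ = (∑ i ∈ Finset.range L, f i * (i : ℤ) ^ j) * (c ^ (s - j) * (s.choose j : ℤ)) := by
          rw [Finset.sum_mul]
          exact Finset.sum_congr rfl fun i _ => by ring
      _ = 0 := by rw [hj', zero_mul]

namespace IsPSequence

variable {n L : ℕ} {f : ℕ → ℤ} {ε : ℤ}

theorem moment_sub_delay (h : IsPSequence n f L ε) (m : ℕ) :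
    ∀ s < n + 1, ∑ i ∈ Finset.range (L + m), (f i - delay m f i) * (i : ℤ) ^ s = 0 := by
  intro s hs
  simp only [sub_mul, Finset.sum_sub_distrib]
  rw [sum_range_add_eq_of_eq_zero h.eq_zero m (fun i => (i : ℤ) ^ s),
    sum_delay_mul m L f (fun i => (i : ℤ) ^ s)]
  push_cast
  rw [sum_mul_add_pow_eq h.moment m (Nat.lt_succ_iff.1 hs), sub_self]

theorem sub_delay_length (h : IsPSequence n f L (-1)) :
    IsPSequence (n + 1) (fun i => f i - delay L f i) (L + L) 1 := by
  have h2 := h.two_le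
  have hlast : f (L - 1) = -1 := by simpa [h.zero] using h.reflect 0 (by omega)
  have hlast' : f (L - 2) = 1 := by
    simpa [h.one, show L - 1 - 1 = L - 2 by omega] using h.reflect 1 (by omega)
  have hlt : ∀ i, i < L → f i - delay L f i = f i := fun i hi => by
    simp [delay, Nat.not_le.2 hi]
  have hge : ∀ i, L ≤ i → f i - delay L f i = -f (i - L) := fun i hi => by
    simp [delay, hi, h.eq_zero i hi]
  refine ⟨by omega, fun i hi => ?_, fun i hi => ?_, ?_, ?_, fun i => ?_, fun i => ?_,
    h.moment_sub_delay L⟩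
  · rw [hge i (by omega), h.eq_zero _ (by omega), neg_zero]
  · rcases lt_or_ge i L with hi' | hi'
    · rw [hlt i hi', hge _ (by omega), show L + L - 1 - i - L = L - 1 - i by omega,
        h.reflect i hi']
      ring
    · rw [hge i hi', hlt _ (by omega), show L + L - 1 - i = L - 1 - (i - L) by omega,
        h.reflect _ (by omega)]
      ring
  · rw [hlt 0 (by omega), h.zero]
  · rw [hlt 1 (by omega), h.one]
  · rcases lt_or_ge i L with hi | hi
    · rw [hlt i hi]; exact h.bound i
    · rw [hge i hi, abs_neg]; exact h.bound _
  · rcases lt_or_ge (i + 2) L with hi | hi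
    · rw [hlt i (by omega), hlt _ hi]; exact h.bound_add i
    rw [hge _ hi]
    rcases lt_or_ge i L with hi' | hi'
    · rw [hlt i hi']
      obtain rfl | rfl : i = L - 2 ∨ i = L - 1 := by omega
      · rw [hlast', show L - 2 + 2 - L = 0 by omega, h.zero]; simp
      · rw [hlast, show L - 1 + 2 - L = 1 by omega, h.one]; simp
    · rw [hge i hi', ← neg_add, abs_neg, show i + 2 - L = i - L + 2 by omega]
      exact h.bound_add _

theorem sub_delay_pred_length (h : IsPSequence n f L 1) :
    IsPSequence (n + 1) (fun i => f i - delay (L - 1) f i) (L + (L - 1)) (-1) := by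
  have h2 := h.two_le
  have hlast : f (L - 1) = 1 := by simpa [h.zero] using h.reflect 0 (by omega)
  have hlast' : f (L - 2) = -1 := by
    simpa [h.one, show L - 1 - 1 = L - 2 by omega] using h.reflect 1 (by omega)
  have hL : 3 ≤ L := by
    by_contra hL
    obtain rfl : L = 2 := by omega
    norm_num [h.zero] at hlast'
  have hlt : ∀ i, i < L - 1 → f i - delay (L - 1) f i = f i := fun i hi => by
    simp [delay, Nat.not_le.2 hi]
  have heq : f (L - 1) - delay (L - 1) f (L - 1) = 0 := by simp [delay, hlast, h.zero]
  have hge : ∀ i, L ≤ i → f i - delay (L - 1) f i = -f (i - (L - 1)) := fun i hi => by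
    rw [delay, if_pos (by omega), h.eq_zero i hi, zero_sub]
  refine ⟨by omega, fun i hi => ?_, fun i hi => ?_, ?_, ?_, fun i => ?_, fun i => ?_,
    h.moment_sub_delay (L - 1)⟩
  · rw [hge i (by omega), h.eq_zero _ (by omega), neg_zero]
  · rcases lt_trichotomy i (L - 1) with hi' | rfl | hi'
    · rw [hlt i hi', hge _ (by omega),
        show L + (L - 1) - 1 - i - (L - 1) = L - 1 - i by omega, h.reflect i (by omega)]
      ring
    · rw [show L + (L - 1) - 1 - (L - 1) = L - 1 by omega, heq]; simp
    · rw [hge i (by omega), hlt _ (by omega),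
        show L + (L - 1) - 1 - i = L - 1 - (i - (L - 1)) by omega, h.reflect _ (by omega)]
      ring
  · rw [hlt 0 (by omega), h.zero]
  · rw [hlt 1 (by omega), h.one]
  · rcases lt_trichotomy i (L - 1) with hi | rfl | hi
    · rw [hlt i hi]; exact h.bound i
    · rw [heq]; simp
    · rw [hge i (by omega), abs_neg]; exact h.bound _
  · rcases lt_or_ge (i + 2) (L - 1) with hi | hi
    · rw [hlt i (by omega), hlt _ hi]; exact h.bound_add i
    rcases lt_trichotomy i (L - 1) with hi' | rfl | hi'
    · rw [hlt i hi']
      obtain rfl | hi : i = L - 2 ∨ i + 2 = L - 1 := by omega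
      · rw [hlast', hge _ (by omega), show L - 2 + 2 - (L - 1) = 1 by omega, h.one]; simp
      · rw [hi, heq, add_zero]; exact h.bound i
    · rw [heq, hge _ (by omega), zero_add, abs_neg]; exact h.bound _
    · rw [hge i (by omega), hge _ (by omega), ← neg_add, abs_neg,
        show i + 2 - (L - 1) = i - (L - 1) + 2 by omega]
      exact h.bound_add _

end IsPSequence

theorem List.getLast!_eq_getD (a : List ℤ) (h : a ≠ []) : a.getLast! = a.getD (a.length - 1) 0 := by
  rw [List.getLast!_of_getLast? (List.getLast?_eq_some_getLast h), List.getLast_eq_getElem,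
    List.getD_eq_getElem]

theorem List.head!_eq_getD (a : List ℤ) (h : a ≠ []) : a.head! = a.getD 0 0 := by
  cases a <;> simp_all

theorem Pnext_isPSequence {n : ℕ} {ε : ℤ} {a : List ℤ} (hε : ε = 1 ∨ ε = -1)
    (h : IsPSequence n (fun i => a.getD i 0) a.length ε) :
    IsPSequence (n + 1) (fun i => (Pnext a).getD i 0) (Pnext a).length (-ε) := by
  have h2 := h.two_le
  have hne : a ≠ [] := by rintro rfl; simp at h2
  have hlast : a.getLast! = ε := by
    have := h.reflect 0 (by omega)
    simp only [h.zero, mul_one, Nat.sub_zero] at this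
    rw [List.getLast!_eq_getD a hne, this]
  have hhead : a.head! = 1 := by rw [List.head!_eq_getD a hne]; exact h.zero
  rcases hε with rfl | rfl
  · have hP : Pnext a = a.dropLast ++ [0] ++ (a.dropLast.reverse.map (fun x => -x)) := by
      rw [Pnext, hlast, hhead, if_neg (by norm_num)]
    have hlen : (Pnext a).length = a.length + (a.length - 1) := by
      simp [hP]; omega
    rw [hlen]
    convert h.sub_delay_pred_length using 1
    ext i
    have hr := h.reflect
    have hz := h.eq_zero
    have h0 := h.zero
    simp only [hP, delay, List.getD_eq_getElem?_getD] at *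
    rcases lt_trichotomy i (a.length - 1) with hi | rfl | hi
    · rw [if_neg (by omega), List.append_assoc, List.getElem?_append_left (by simpa using hi),
        List.getElem?_dropLast, if_pos hi, sub_zero]
    · have := hr 0 (by omega)
      rw [Nat.sub_zero, one_mul, h0] at this
      rw [List.append_assoc, List.getElem?_append_right (by simp), if_pos le_rfl, this, Nat.sub_self,
        h0]
      simp
    · rw [if_pos hi.le, hz i (by omega), List.getElem?_append_right (by simp; omega)]
      rcases lt_or_ge i (a.length + (a.length - 1)) with hi' | hi'
      · have := hr (i - (a.length - 1)) (by omega)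
        rw [one_mul] at this
        rw [← this, List.getElem?_map, List.getElem?_reverse (by simp; omega),
          List.getElem?_dropLast, if_pos (by simp; omega)]
        simp only [List.length_append, List.length_dropLast, List.length_cons, List.length_nil]
        rw [show a.length - 1 - 1 - (i - (a.length - 1 + (0 + 1))) =
          a.length - 1 - (i - (a.length - 1)) by omega, List.getElem?_eq_getElem (by omega)]
        simp
      · rw [hz _ (by omega), List.getElem?_eq_none (by simp; omega)]
        simp
  · have hP : Pnext a = a ++ a.reverse := by
      rw [Pnext, hlast, hhead, if_pos rfl]
    have hlen : (Pnext a).length = a.length + a.length := by simp [hP]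
    rw [hlen, neg_neg]
    convert h.sub_delay_length using 1
    ext i
    have hr := h.reflect
    have hz := h.eq_zero
    simp only [hP, delay, List.getD_eq_getElem?_getD] at *
    rcases lt_or_ge i a.length with hi | hi
    · rw [if_neg (by omega), List.getElem?_append_left hi, sub_zero]
    · rw [if_pos hi, hz i hi, List.getElem?_append_right hi]
      rcases lt_or_ge (i - a.length) a.length with hi' | hi'
      · rw [List.getElem?_reverse hi', hr _ hi']
        ring
      · rw [hz _ hi', List.getElem?_eq_none (by simpa using hi')]
        simp

theorem Pseq_isPSequence (n : ℕ) : ∃ ε : ℤ, (ε = 1 ∨ ε = -1) ∧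
    IsPSequence (n + 1) (fun i => (Pseq n).getD i 0) (Pseq n).length ε := by
  induction n with
  | zero =>
    refine ⟨-1, .inr rfl, ?_, fun i hi => ?_, fun i hi => ?_, ?_, ?_, fun i => ?_, fun i => ?_,
      fun s hs => ?_⟩
    · simp [Pseq]
    · exact List.getD_eq_default _ _ hi
    · simp only [Pseq, List.length_cons, List.length_nil] at hi ⊢
      interval_cases i <;> simp
    · simp [Pseq]
    · simp [Pseq]
    · rcases i with _ | _ | i <;> simp [Pseq]
    · rcases i with _ | _ | i <;> simp [Pseq]
    · obtain rfl : s = 0 := by omega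
      simp [Pseq, Finset.sum_range_succ]
  | succ n ih =>
    obtain ⟨ε, hε, h⟩ := ih
    exact ⟨-ε, by rcases hε with rfl | rfl <;> simp, Pnext_isPSequence hε h⟩

theorem sum_filter_eq_one_eq_sum_filter_eq_neg_one {N : ℕ} {b : ℕ → ℤ}
    (hb : ∀ i < N, b i = -1 ∨ b i = 0 ∨ b i = 1) (w : ℕ → ℕ)
    (h : ∑ i ∈ Finset.range N, b i * (w i : ℤ) = 0) :
    ∑ i ∈ (Finset.range N).filter (fun i => b i = 1), w i =
      ∑ i ∈ (Finset.range N).filter (fun i => b i = -1), w i := by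
  zify
  rw [← sub_eq_zero, ← h, Finset.sum_filter, Finset.sum_filter, ← Finset.sum_sub_distrib]
  refine Finset.sum_congr rfl fun i hi => ?_
  rcases hb i (Finset.mem_range.1 hi) with h | h | h <;> simp [h]

/-- for `n ≥ 2` and `P_n = ⟨a_0,…,a_k⟩`, define
`Q_n = ⟨b_0,…,b_{k+2}⟩` by adding `P_n` to its shift by two positions
(`b_i = a_i + a_{i-2}`, with out-of-range entries read as `0`).  Then each
`b_i ∈ {-1,0,1}`, `Q_n` has as many entries `1` as entries `-1`, and
`U = {i+1 : b_i = 1}`, `V = {i+1 : b_i = -1}` are disjoint sets of equal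
cardinality with `∑_{u∈U} u^s = ∑_{v∈V} v^s` for `s = 0,…,n-1`. -/
theorem Qseq_ProuhetTarryEscott (n : ℕ) (hn : 2 ≤ n) :
    let a := Pseq (n - 1)
    let k := a.length - 1
    let b : ℕ → ℤ := fun i => a.getD i 0 + (if 2 ≤ i then a.getD (i - 2) 0 else 0)
    let U : Finset ℕ :=
      ((Finset.range (k + 3)).filter (fun i => b i = 1)).image (fun i => i + 1)
    let V : Finset ℕ :=
      ((Finset.range (k + 3)).filter (fun i => b i = -1)).image (fun i => i + 1)
    (∀ i ≤ k + 2, b i = -1 ∨ b i = 0 ∨ b i = 1) ∧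
    ((Finset.range (k + 3)).filter (fun i => b i = 1)).card =
      ((Finset.range (k + 3)).filter (fun i => b i = -1)).card ∧
    Disjoint U V ∧ U.card = V.card ∧
    ∀ s : ℕ, s < n → ∑ u ∈ U, u ^ s = ∑ v ∈ V, v ^ s := by
  intro a k b U V
  obtain ⟨m, rfl⟩ : ∃ m, n = m + 1 := ⟨n - 1, by omega⟩
  obtain ⟨ε, -, h⟩ := Pseq_isPSequence m
  change IsPSequence (m + 1) (fun i => a.getD i 0) a.length ε at h
  have h2 : 2 ≤ a.length := h.two_le
  have hk : k + 3 = a.length + 2 := by omega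
  have hb : ∀ i, b i = -1 ∨ b i = 0 ∨ b i = 1 := by
    intro i
    have habs : |b i| ≤ 1 := by
      by_cases hi : 2 ≤ i
      · obtain ⟨j, rfl⟩ := Nat.exists_eq_add_of_le' hi
        simpa [b, add_comm] using h.bound_add j
      · simpa [b, hi] using h.bound i
    have := abs_le.1 habs
    omega
  have hmoment : ∀ s < m + 1, ∑ i ∈ Finset.range (k + 3), b i * (((i + 1) ^ s : ℕ) : ℤ) = 0 := by
    intro s hs
    have hsplit : ∀ i, b i = a.getD i 0 + delay 2 (fun i => a.getD i 0) i := fun i => rfl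
    simp only [hsplit, add_mul, Finset.sum_add_distrib]
    rw [hk, sum_range_add_eq_of_eq_zero h.eq_zero 2 (fun i => (((i + 1) ^ s : ℕ) : ℤ)),
      sum_delay_mul 2 a.length _ (fun i => (((i + 1) ^ s : ℕ) : ℤ))]
    push_cast
    simp only [add_assoc]
    rw [sum_mul_add_pow_eq h.moment _ hs.le, sum_mul_add_pow_eq h.moment _ hs.le,
      h.moment s hs, add_zero]
  have hsum := fun s hs => sum_filter_eq_one_eq_sum_filter_eq_neg_one (fun i _ => hb i)
    (fun i => (i + 1) ^ s) (hmoment s hs)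
  have hinj : Function.Injective (fun i : ℕ => i + 1) := add_left_injective 1
  have hcard : ((Finset.range (k + 3)).filter (fun i => b i = 1)).card =
      ((Finset.range (k + 3)).filter (fun i => b i = -1)).card := by
    simpa using hsum 0 m.succ_pos
  refine ⟨fun i _ => hb i, hcard, ?_, ?_, fun s hs => ?_⟩
  · rw [Finset.disjoint_image hinj, Finset.disjoint_filter]
    intro i _ h1
    rw [h1]
    norm_num
  · rw [Finset.card_image_of_injective _ hinj, Finset.card_image_of_injective _ hinj, hcard]
  · rw [Finset.sum_image hinj.injOn, Finset.sum_image hinj.injOn]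
    exact hsum s hs
end
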